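/- arXiv:2210.10095 — 2 statements merged into one kernel-verified Lean document; each statement's English description precedes it below -/
import Mathlib

section
/- Let W be the affine space of linear maps from ℂ^{n+1} to ℂⁿ (n ≥ 2), with SL_n(ℂ) acting by postcomposition. Then: (1) the action is free exactly on the open set U of surjective linear maps; (2) U // SL_n(ℂ) ≅ 𝔸^{n+1} ∖ {0} and W // SL_n(ℂ) ≅ 𝔸^{n+1}; (3) the complement of U in W has codimension ≥ 2. Hence W → 𝔸^{n+1} is an SL_n(ℂ)-quasi-torsor over the smooth germ (𝔸^{n+1}; 0) that is not a torsor. -/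
open Matrix

/-- The `n+1` maximal minors of an `n × (n+1)` matrix `A` (the column-deleted
determinants); these generate the ring of `SLₙ`-invariants of the space `W` of linear
maps `ℂ^{n+1} → ℂⁿ`. -/
noncomputable def maximalMinors (n : ℕ) (A : Matrix (Fin n) (Fin (n + 1)) ℂ) :
    Fin (n + 1) → ℂ :=
  fun i => (A.submatrix id i.succAbove).det

/-- The `i`-th maximal minor as a polynomial in the matrix entries. -/
noncomputable def minorPoly (n : ℕ) (i : Fin (n + 1)) :
    MvPolynomial (Fin n × Fin (n + 1)) ℂ :=
  (Matrix.of fun r c => (MvPolynomial.X (r, i.succAbove c) :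
    MvPolynomial (Fin n × Fin (n + 1)) ℂ)).det


namespace SLQT

lemma kernel_minors (n : ℕ) (A : Matrix (Fin n) (Fin (n + 1)) ℂ) (r : Fin n) :
    ∑ j : Fin (n + 1), (-1 : ℂ) ^ (j : ℕ) * maximalMinors n A j * A r j = 0 := by
  have h : (Matrix.of (Fin.cons (A r) (fun k => A k) : Fin (n + 1) → Fin (n + 1) → ℂ)).det = 0 := by
    apply Matrix.det_zero_of_row_eq (i := 0) (j := r.succ) (Fin.succ_ne_zero r).symm
    ext j
    simp
  rw [Matrix.det_succ_row_zero] at h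
  rw [← h]
  refine Finset.sum_congr rfl fun j _ => ?_
  have : (Matrix.of (Fin.cons (A r) (fun k => A k) : Fin (n + 1) → Fin (n + 1) → ℂ)).submatrix
      Fin.succ j.succAbove = A.submatrix id j.succAbove := by
    ext a b
    simp
  rw [this]
  simp only [maximalMinors, Matrix.of_apply, Fin.cons_zero]
  ring

lemma minors_mul (n : ℕ) (g : Matrix (Fin n) (Fin n) ℂ) (A : Matrix (Fin n) (Fin (n + 1)) ℂ)
    (i : Fin (n + 1)) :
    maximalMinors n (g * A) i = g.det * maximalMinors n A i := by
  simp only [maximalMinors]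
  rw [← Matrix.det_mul]
  congr 1

lemma minors_ne_zero_iff (n : ℕ) (A : Matrix (Fin n) (Fin (n + 1)) ℂ) :
    maximalMinors n A ≠ 0 ↔ Function.Surjective A.mulVecLin := by
  constructor
  · intro h
    obtain ⟨i, hi⟩ := Function.ne_iff.mp h
    have hu : IsUnit (A.submatrix id i.succAbove) := by
      rw [Matrix.isUnit_iff_isUnit_det]
      exact isUnit_iff_ne_zero.mpr hi
    have hs := Matrix.mulVec_surjective_iff_isUnit.mpr hu
    intro y
    obtain ⟨x, hx⟩ := hs y
    refine ⟨i.insertNth (0 : ℂ) x, ?_⟩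
    rw [← hx]
    ext r
    simp [Matrix.mulVec, dotProduct, Fin.sum_univ_succAbove _ i]
  · intro h
    obtain ⟨k, hk, hk0⟩ := Matrix.exists_mulVec_eq_zero_iff.mpr
      (show (Matrix.of (Fin.cons 0 (fun k => A k) : Fin (n + 1) → Fin (n + 1) → ℂ)).det = 0 from
        Matrix.det_eq_zero_of_row_eq_zero 0 (by intro j; simp))
    have hAk : A *ᵥ k = 0 := by
      ext r
      have := congrFun hk0 r.succ
      simpa [Matrix.mulVec] using this
    obtain ⟨i, hi⟩ := Function.ne_iff.mp hk
    simp only [Pi.zero_apply] at hi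
    have hs : Function.Surjective (A.submatrix id i.succAbove).mulVec := by
      intro y
      obtain ⟨x, hx⟩ := h y
      simp only [Matrix.mulVecLin_apply] at hx
      have hx2 : A *ᵥ (x - (x i / k i) • k) = y := by
        rw [Matrix.mulVec_sub, Matrix.mulVec_smul, hAk, hx]; simp
      refine ⟨fun j => (x - (x i / k i) • k) (i.succAbove j), ?_⟩
      rw [← hx2]
      ext r
      have : x i - x i / k i * k i = 0 := by field_simp; ring
      simp [Matrix.mulVec, dotProduct, Fin.sum_univ_succAbove _ i, this]
    have hu := Matrix.mulVec_surjective_iff_isUnit.mp hs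
    rw [Matrix.isUnit_iff_isUnit_det] at hu
    intro h0
    exact hu.ne_zero (congrFun h0 i)

lemma eq_of_minors (n : ℕ) (A B : Matrix (Fin n) (Fin (n + 1)) ℂ) (i : Fin (n + 1))
    (hi : maximalMinors n A i ≠ 0) (h : maximalMinors n A = maximalMinors n B)
    (hc : A.submatrix id i.succAbove = B.submatrix id i.succAbove) : A = B := by
  have hc' : ∀ r j, A r (i.succAbove j) = B r (i.succAbove j) := fun r j =>
    congrFun (congrFun hc r) j
  ext r c
  have h1 := kernel_minors n A r
  have h2 := kernel_minors n B r
  rw [← h] at h2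
  rw [Fin.sum_univ_succAbove _ i] at h1 h2
  simp only [hc'] at h1
  have h3 : (-1 : ℂ) ^ (i : ℕ) * maximalMinors n A i * A r i
      = (-1 : ℂ) ^ (i : ℕ) * maximalMinors n A i * B r i := by
    linear_combination h1 - h2
  have h4 : (-1 : ℂ) ^ (i : ℕ) * maximalMinors n A i ≠ 0 := mul_ne_zero (by simp) hi
  rcases Fin.eq_self_or_eq_succAbove i c with rfl | ⟨j, rfl⟩
  · exact mul_left_cancel₀ h4 h3
  · exact hc' r j

lemma single_orbit (n : ℕ) (A B : Matrix (Fin n) (Fin (n + 1)) ℂ)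
    (hA : maximalMinors n A ≠ 0) (h : maximalMinors n A = maximalMinors n B) :
    ∃ g : SpecialLinearGroup (Fin n) ℂ, (g : Matrix (Fin n) (Fin n) ℂ) * A = B := by
  obtain ⟨i, hi⟩ := Function.ne_iff.mp hA
  simp only [Pi.zero_apply] at hi
  have hu : IsUnit (A.submatrix id i.succAbove).det := isUnit_iff_ne_zero.mpr hi
  set g := B.submatrix id i.succAbove * (A.submatrix id i.succAbove)⁻¹ with hg
  have hgA : g * A.submatrix id i.succAbove = B.submatrix id i.succAbove := by
    rw [hg, Matrix.mul_assoc, Matrix.nonsing_inv_mul _ hu, Matrix.mul_one]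
  have hdet : g.det = 1 := by
    have := congrArg Matrix.det hgA
    rw [Matrix.det_mul] at this
    have h2 : (A.submatrix id i.succAbove).det = (B.submatrix id i.succAbove).det := congrFun h i
    rw [← h2] at this
    exact mul_right_cancel₀ hi (by rw [one_mul]; exact this)
  refine ⟨⟨g, hdet⟩, ?_⟩
  have hm : maximalMinors n (g * A) = maximalMinors n A := by
    ext j; rw [minors_mul, hdet, one_mul]
  apply eq_of_minors n (g * A) B i
  · rw [hm]; exact hi
  · rw [hm, h]
  · rw [← hgA]; rfl

/-- Local section of the minors map over the locus where the `i`-th coordinate is nonzero. -/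
noncomputable def sec (n : ℕ) (i : Fin (n + 1)) (m : Fin (n + 1) → ℂ) :
    Matrix (Fin n) (Fin (n + 1)) ℂ :=
  Matrix.of fun r => i.insertNth
    (-(((-1) ^ (i : ℕ))⁻¹ * (m i)⁻¹ * ((-1) ^ (i.succAbove r : ℕ) * m (i.succAbove r) *
      (if (r : ℕ) = 0 then m i else 1))))
    (Matrix.diagonal (fun r : Fin n => if (r : ℕ) = 0 then m i else 1) r)

lemma minors_sec (n : ℕ) (hn : 2 ≤ n) (i : Fin (n + 1)) (m : Fin (n + 1) → ℂ) (hm : m i ≠ 0) :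
    maximalMinors n (sec n i m) = m := by
  have hsub : (sec n i m).submatrix id i.succAbove =
      Matrix.diagonal (fun r : Fin n => if (r : ℕ) = 0 then m i else 1) := by
    ext r j
    simp [sec]
  have hi : maximalMinors n (sec n i m) i = m i := by
    simp only [maximalMinors]
    rw [hsub, Matrix.det_diagonal]
    rw [Finset.prod_eq_single (⟨0, by omega⟩ : Fin n)]
    · simp
    · intro b _ hb
      rw [if_neg]
      intro h
      exact hb (Fin.ext h)
    · simp
  have hker : ∀ r, ∑ j : Fin (n + 1), (-1 : ℂ) ^ (j : ℕ) * m j * sec n i m r j = 0 := by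
    intro r
    rw [Fin.sum_univ_succAbove _ i]
    simp only [sec, Matrix.of_apply, Fin.insertNth_apply_same, Fin.insertNth_apply_succAbove]
    rw [Finset.sum_eq_single r]
    · rw [Matrix.diagonal_apply_eq]
      have : ((-1 : ℂ) ^ (i : ℕ)) ≠ 0 := by simp
      field_simp
      ring
    · intro b _ hb
      rw [Matrix.diagonal_apply_ne _ hb.symm, mul_zero]
    · simp
  ext c
  rcases Fin.eq_self_or_eq_succAbove i c with rfl | ⟨r, rfl⟩
  · exact hi
  · have h1 := kernel_minors n (sec n i m) r
    have h2 := hker r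
    rw [Fin.sum_univ_succAbove _ i] at h1 h2
    rw [hi] at h1
    have h3 : ∀ j, sec n i m r (i.succAbove j) =
        Matrix.diagonal (fun r : Fin n => if (r : ℕ) = 0 then m i else 1) r j := fun j =>
      congrFun (congrFun hsub r) j
    simp only [h3] at h1 h2
    rw [Finset.sum_eq_single r (fun b _ hb => by
      rw [Matrix.diagonal_apply_ne _ hb.symm, mul_zero]) (by simp)] at h1 h2
    rw [Matrix.diagonal_apply_eq] at h1 h2
    have h4 : (-1 : ℂ) ^ (i.succAbove r : ℕ) * (if (r : ℕ) = 0 then m i else 1) ≠ 0 := by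
      apply mul_ne_zero (by simp)
      split_ifs
      · exact hm
      · exact one_ne_zero
    apply mul_left_cancel₀ h4
    linear_combination h1 - h2

lemma minors_zero (n : ℕ) (hn : 2 ≤ n) : maximalMinors n 0 = 0 := by
  have : Nonempty (Fin n) := ⟨⟨0, by omega⟩⟩
  ext i
  simp [maximalMinors]

lemma minors_surjective (n : ℕ) (hn : 2 ≤ n) : Function.Surjective (maximalMinors n) := by
  intro m
  by_cases h : m = 0
  · exact ⟨0, by rw [h, minors_zero n hn]⟩
  · obtain ⟨i, hi⟩ := Function.ne_iff.mp h
    exact ⟨sec n i m, minors_sec n hn i m hi⟩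

lemma exists_stab (n : ℕ) (hn : 2 ≤ n) (A : Matrix (Fin n) (Fin (n + 1)) ℂ)
    (hA : ¬ Function.Surjective A.mulVecLin) :
    ∃ g : SpecialLinearGroup (Fin n) ℂ, g ≠ 1 ∧ (g : Matrix (Fin n) (Fin n) ℂ) * A = A := by
  obtain ⟨f, hf, hfr⟩ := Submodule.exists_le_ker_of_lt_top (LinearMap.range A.mulVecLin)
    (lt_top_iff_ne_top.mpr fun h => hA (LinearMap.range_eq_top.mp h))
  set v : Fin n → ℂ := fun r => f (Pi.single r 1) with hv
  have hfv : ∀ x, f x = v ⬝ᵥ x := by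
    intro x
    rw [LinearMap.pi_apply_eq_sum_univ f x]
    simp only [hv, dotProduct, smul_eq_mul]
    refine Finset.sum_congr rfl fun r _ => ?_
    rw [mul_comm]
    congr 2
    ext j
    simp [Pi.single_apply, eq_comm]
  have hv0 : v ≠ 0 := by
    intro h
    apply hf
    ext x
    simp [hfv, h]
  have hvA : v ᵥ* A = 0 := by
    ext c
    have h1 : A *ᵥ (Pi.single c 1) ∈ LinearMap.ker f := hfr ⟨Pi.single c 1, rfl⟩
    rw [LinearMap.mem_ker, hfv] at h1
    simpa [Matrix.vecMul, dotProduct] using h1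
  obtain ⟨u, hu0, hvu⟩ : ∃ u : Fin n → ℂ, u ≠ 0 ∧ v ⬝ᵥ u = 0 := by
    obtain ⟨u, hu, hu0⟩ := Matrix.exists_mulVec_eq_zero_iff.mpr
      (show (Matrix.of fun _ : Fin n => v).det = 0 from
        Matrix.det_zero_of_row_eq (i := ⟨0, by omega⟩) (j := ⟨1, by omega⟩) (by simp) rfl)
    exact ⟨u, hu, congrFun hu0 ⟨0, by omega⟩⟩
  have hdet : (1 + Matrix.replicateCol Unit u * Matrix.replicateRow Unit v).det = 1 := by
    rw [Matrix.det_one_add_replicateCol_mul_replicateRow, hvu, add_zero]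
  refine ⟨⟨_, hdet⟩, ?_, ?_⟩
  · intro h
    have h1 : (1 + Matrix.replicateCol Unit u * Matrix.replicateRow Unit v) = 1 :=
      congrArg Subtype.val h
    obtain ⟨a, ha⟩ := Function.ne_iff.mp hu0
    obtain ⟨b, hb⟩ := Function.ne_iff.mp hv0
    have h2 := congrFun (congrFun (add_eq_left.mp h1) a) b
    simp [Matrix.mul_apply] at h2
    exact h2.elim ha hb
  · change (1 + Matrix.replicateCol Unit u * Matrix.replicateRow Unit v) * A = A
    rw [Matrix.add_mul, Matrix.one_mul, Matrix.mul_assoc]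
    have : Matrix.replicateRow Unit v * A = 0 := by
      ext a c
      have := congrFun hvA c
      simpa [Matrix.mul_apply, Matrix.vecMul, dotProduct] using this
    rw [this, Matrix.mul_zero, add_zero]

lemma free_iff (n : ℕ) (hn : 2 ≤ n) (A : Matrix (Fin n) (Fin (n + 1)) ℂ) :
    (∀ g : SpecialLinearGroup (Fin n) ℂ, (g : Matrix (Fin n) (Fin n) ℂ) * A = A → g = 1)
      ↔ Function.Surjective A.mulVecLin := by
  constructor
  · intro h
    by_contra hA
    obtain ⟨g, hg, hgA⟩ := exists_stab n hn A hA
    exact hg (h g hgA)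
  · intro h g hg
    obtain ⟨B, hB⟩ := Matrix.mulVec_surjective_iff_exists_right_inverse.mp h
    apply Subtype.ext
    have := congrArg (· * B) hg
    simp only [Matrix.mul_assoc, hB, Matrix.mul_one] at this
    exact this

open MvPolynomial

lemma minorPoly_eq_rename (n : ℕ) (i : Fin (n + 1)) :
    minorPoly n i = rename (fun p : Fin n × Fin n => (p.1, i.succAbove p.2))
      (Matrix.mvPolynomialX (Fin n) (Fin n) ℂ).det := by
  rw [AlgHom.map_det]
  simp only [minorPoly]
  congr 1
  ext1 a b
  simp

lemma minorPoly_ne_zero (n : ℕ) (i : Fin (n + 1)) : minorPoly n i ≠ 0 := by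
  rw [minorPoly_eq_rename]
  intro h
  refine Matrix.det_mvPolynomialX_ne_zero (Fin n) ℂ
    (rename_injective _ ?_ (h.trans (map_zero _).symm))
  rintro ⟨a, b⟩ ⟨c, d⟩ h
  simpa using h

lemma eval_minorPoly (n : ℕ) (i : Fin (n + 1)) (A : Matrix (Fin n) (Fin (n + 1)) ℂ) :
    eval (fun p => A p.1 p.2) (minorPoly n i) = maximalMinors n A i := by
  simp only [minorPoly, maximalMinors]
  rw [RingHom.map_det]
  congr 1
  ext1 a b
  simp

lemma eval_bind_minor (n : ℕ) (G : MvPolynomial (Fin (n + 1)) ℂ)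
    (A : Matrix (Fin n) (Fin (n + 1)) ℂ) :
    eval (fun p => A p.1 p.2) (bind₁ (minorPoly n) G) = eval (maximalMinors n A) G := by
  have h : maximalMinors n A = fun i => eval (fun p => A p.1 p.2) (minorPoly n i) := by
    ext i
    rw [eval_minorPoly]
  rw [h]
  exact eval₂Hom_bind₁ _ _ _ _

lemma clear_denom {σ τ : Type*} (s : σ → (τ → ℂ) → ℂ) (i : τ)
    (hs : ∀ p, ∃ Q : MvPolynomial τ ℂ, ∀ m, m i ≠ 0 → m i * s p m = eval m Q)
    (F : MvPolynomial σ ℂ) :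
    ∃ (N : ℕ) (P : MvPolynomial τ ℂ), ∀ m, m i ≠ 0 →
      m i ^ N * eval (fun p => s p m) F = eval m P := by
  induction F using MvPolynomial.induction_on with
  | C a => exact ⟨0, C a, by simp⟩
  | add p q hp hq =>
    obtain ⟨N, P, h⟩ := hp
    obtain ⟨M, Q, h'⟩ := hq
    refine ⟨N + M, X i ^ M * P + X i ^ N * Q, fun m hm => ?_⟩
    simp only [map_add, map_mul, map_pow, eval_X, ← h m hm, ← h' m hm]
    ring
  | mul_X p a hp =>
    obtain ⟨N, P, h⟩ := hp
    obtain ⟨Q, h'⟩ := hs a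
    refine ⟨N + 1, P * Q, fun m hm => ?_⟩
    simp only [map_mul, eval_X, ← h m hm, ← h' m hm]
    ring

lemma sec_poly (n : ℕ) (i : Fin (n + 1)) (p : Fin n × Fin (n + 1)) :
    ∃ Q : MvPolynomial (Fin (n + 1)) ℂ, ∀ m, m i ≠ 0 → m i * sec n i m p.1 p.2 = eval m Q := by
  obtain ⟨r, c⟩ := p
  rcases Fin.eq_self_or_eq_succAbove i c with rfl | ⟨j, rfl⟩
  · refine ⟨-(C (((-1) ^ (c : ℕ))⁻¹ * (-1) ^ (c.succAbove r : ℕ)) * X (c.succAbove r) *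
      (if (r : ℕ) = 0 then X c else 1)), fun m hm => ?_⟩
    simp only [sec, Matrix.of_apply, Fin.insertNth_apply_same, map_neg, map_mul, eval_X, eval_C]
    split_ifs <;> simp only [eval_X, map_one] <;> field_simp
  · refine ⟨X i * Matrix.diagonal (fun r : Fin n => if (r : ℕ) = 0 then X i else 1) r j,
      fun m hm => ?_⟩
    simp only [sec, Matrix.of_apply, Fin.insertNth_apply_succAbove, map_mul, eval_X,
      Matrix.diagonal_apply]
    split_ifs <;> simp

lemma local_form (n : ℕ) (hn : 2 ≤ n) (F : MvPolynomial (Fin n × Fin (n + 1)) ℂ)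
    (hF : ∀ (g : SpecialLinearGroup (Fin n) ℂ) (A : Matrix (Fin n) (Fin (n + 1)) ℂ),
        MvPolynomial.eval (fun p => ((g : Matrix (Fin n) (Fin n) ℂ) * A) p.1 p.2) F
          = MvPolynomial.eval (fun p => A p.1 p.2) F) (i : Fin (n + 1)) :
    ∃ (N : ℕ) (P : MvPolynomial (Fin (n + 1)) ℂ), ∀ A : Matrix (Fin n) (Fin (n + 1)) ℂ,
      maximalMinors n A i ≠ 0 →
      maximalMinors n A i ^ N * eval (fun p => A p.1 p.2) F = eval (maximalMinors n A) P := by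
  obtain ⟨N, P, h⟩ := clear_denom
    (fun (p : Fin n × Fin (n + 1)) (m : Fin (n + 1) → ℂ) => sec n i m p.1 p.2) i
    (fun p => sec_poly n i p) F
  refine ⟨N, P, fun A hA => ?_⟩
  rw [← h _ hA]
  obtain ⟨g, hg⟩ := single_orbit n A (sec n i (maximalMinors n A))
    (Function.ne_iff.mpr ⟨i, hA⟩) (minors_sec n hn i _ hA).symm
  rw [← hg, hF]

lemma factor (n : ℕ) (hn : 2 ≤ n) (F : MvPolynomial (Fin n × Fin (n + 1)) ℂ)
    (hF : ∀ (g : SpecialLinearGroup (Fin n) ℂ) (A : Matrix (Fin n) (Fin (n + 1)) ℂ),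
        MvPolynomial.eval (fun p => ((g : Matrix (Fin n) (Fin n) ℂ) * A) p.1 p.2) F
          = MvPolynomial.eval (fun p => A p.1 p.2) F) :
    ∃ Gp : MvPolynomial (Fin (n + 1)) ℂ, ∀ A : Matrix (Fin n) (Fin (n + 1)) ℂ,
        MvPolynomial.eval (fun p => A p.1 p.2) F
          = MvPolynomial.eval (maximalMinors n A) Gp := by
  obtain ⟨a, b, hab⟩ : ∃ a b : Fin (n + 1), a ≠ b :=
    ⟨⟨0, by omega⟩, ⟨1, by omega⟩, by simp⟩
  obtain ⟨N, P, hP⟩ := local_form n hn F hF a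
  obtain ⟨M, Q, hQ⟩ := local_form n hn F hF b
  have key : (X a * X b) * (X b ^ M * P) = (X a * X b) * (X a ^ N * Q) := by
    apply MvPolynomial.funext
    intro m
    simp only [map_mul, map_pow, eval_X]
    by_cases ha : m a = 0
    · simp [ha]
    by_cases hb : m b = 0
    · simp [hb]
    have hm := minors_sec n hn a m ha
    have h1 := hP (sec n a m) (by rw [hm]; exact ha)
    have h2 := hQ (sec n a m) (by rw [hm]; exact hb)
    rw [hm] at h1 h2
    rw [← h1, ← h2]
    ring
  have key2 := mul_left_cancel₀ (mul_ne_zero (X_ne_zero a) (X_ne_zero b)) key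
  have hdvd : X a ^ N ∣ P := by
    refine Prime.pow_dvd_of_dvd_mul_left (X_prime) N ?_ (Dvd.intro _ key2.symm)
    intro h
    have := (X_prime (R := ℂ) (i := a)).dvd_of_dvd_pow h
    rw [X_dvd_X] at this
    exact hab this
  obtain ⟨G, rfl⟩ := hdvd
  refine ⟨G, ?_⟩
  have hH : minorPoly n a * F = minorPoly n a * bind₁ (minorPoly n) G := by
    apply MvPolynomial.funext
    intro x
    have e1 : eval x (minorPoly n a) = maximalMinors n (Matrix.of fun i j => x (i, j)) a :=
      eval_minorPoly n a (Matrix.of fun i j => x (i, j))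
    have e2 : eval x (bind₁ (minorPoly n) G) =
        eval (maximalMinors n (Matrix.of fun i j => x (i, j))) G := by
      exact eval_bind_minor n G (Matrix.of fun i j => x (i, j))
    simp only [map_mul]
    rw [e1, e2]
    by_cases h : maximalMinors n (Matrix.of fun i j => x (i, j)) a = 0
    · rw [h]; simp
    have h1 := hP _ h
    simp only [map_mul, map_pow, eval_X] at h1
    rw [← mul_left_cancel₀ (pow_ne_zero N h) h1]
    rfl
  have hFG := mul_left_cancel₀ (minorPoly_ne_zero n a) hH
  intro A
  rw [hFG, eval_bind_minor]

lemma vars_subset_of_dvd {σ : Type*} {p q : MvPolynomial σ ℂ} (h : p ∣ q) (hq : q ≠ 0) :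
    p.vars ⊆ q.vars := by
  classical
  obtain ⟨r, rfl⟩ := h
  have hp := left_ne_zero_of_mul hq
  have hr := right_ne_zero_of_mul hq
  simp only [vars_def]
  rw [degrees_mul_eq hp hr]
  intro x hx
  simp only [Multiset.mem_toFinset, Multiset.mem_add] at hx ⊢
  exact Or.inl hx

lemma not_dvd_all (n : ℕ) (q : MvPolynomial (Fin n × Fin (n + 1)) ℂ) (hq : Prime q)
    (h : ∀ i, q ∣ minorPoly n i) : False := by
  have hv : q.vars = ∅ := by
    rw [Finset.eq_empty_iff_forall_notMem]
    rintro ⟨r, c⟩ hx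
    have := vars_subset_of_dvd (h c) (minorPoly_ne_zero n c) hx
    rw [minorPoly_eq_rename] at this
    obtain ⟨⟨a, b⟩, -, hab⟩ := mem_vars_rename _ _ this
    exact Fin.succAbove_ne c b (Prod.ext_iff.mp hab).2
  rw [vars_eq_empty_iff_eq_C] at hv
  apply hq.not_isUnit
  rw [isUnit_iff_eq_C_of_isReduced]
  refine ⟨_, ?_, hv⟩
  rw [isUnit_iff_ne_zero]
  intro h0
  rw [h0, map_zero] at hv
  exact hq.ne_zero hv

lemma codim (n : ℕ) :
    ringKrullDim
        (MvPolynomial (Fin n × Fin (n + 1)) ℂ ⧸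
          Ideal.span (Set.range fun i : Fin (n + 1) => minorPoly n i)) + 2
      ≤ ringKrullDim (MvPolynomial (Fin n × Fin (n + 1)) ℂ) := by
  set I := Ideal.span (Set.range fun i : Fin (n + 1) => minorPoly n i) with hI
  by_cases hI' : I = ⊤
  · have : Subsingleton (MvPolynomial (Fin n × Fin (n + 1)) ℂ ⧸ I) :=
      Ideal.Quotient.subsingleton_iff.mpr hI'
    rw [ringKrullDim_eq_bot_of_subsingleton]
    simp
  have : Nonempty (PrimeSpectrum.zeroLocus (R := MvPolynomial (Fin n × Fin (n + 1)) ℂ) I) := by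
    rwa [Set.nonempty_coe_sort, Set.nonempty_iff_ne_empty, ne_eq,
      PrimeSpectrum.zeroLocus_empty_iff_eq_top]
  rw [ringKrullDim_quotient, Order.krullDim_eq_iSup_length, ringKrullDim,
    Order.krullDim_eq_iSup_length]
  have h2 : (2 : WithBot ℕ∞) = ((2 : ℕ∞) : WithBot ℕ∞) := rfl
  rw [h2, ← WithBot.coe_add, ENat.iSup_add, WithBot.coe_le_coe, iSup_le_iff]
  intro l
  have hmem : ∀ i, minorPoly n i ∈ l.head.1.asIdeal := fun i =>
    l.head.2 (Ideal.subset_span ⟨i, rfl⟩)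
  obtain ⟨q, hqm, hq⟩ := Ideal.IsPrime.exists_mem_prime_of_ne_bot l.head.1.isPrime
    (fun h => minorPoly_ne_zero n 0 (by simpa [h] using hmem 0))
  let p1 : PrimeSpectrum (MvPolynomial (Fin n × Fin (n + 1)) ℂ) :=
    ⟨Ideal.span {q}, (Ideal.span_singleton_prime hq.ne_zero).mpr hq⟩
  let p0 : PrimeSpectrum (MvPolynomial (Fin n × Fin (n + 1)) ℂ) := ⟨⊥, Ideal.isPrime_bot⟩
  have h1 : p1 < l.head.1 := by
    refine lt_of_le_of_ne ?_ ?_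
    · exact (Ideal.span_singleton_le_iff_mem _).mpr hqm
    · intro h
      refine not_dvd_all n q hq fun i => Ideal.mem_span_singleton.mp ?_
      have := hmem i
      rw [← h] at this
      exact this
  have h0 : p0 < p1 := by
    refine lt_of_le_of_ne (show (⊥ : Ideal _) ≤ _ from bot_le) ?_
    intro h
    have h' : (⊥ : Ideal (MvPolynomial (Fin n × Fin (n + 1)) ℂ)) = Ideal.span {q} :=
      congrArg PrimeSpectrum.asIdeal h
    exact hq.ne_zero (Ideal.span_singleton_eq_bot.mp h'.symm)
  refine le_trans ?_ (le_iSup _ (((l.map Subtype.val (fun _ _ ↦ id)).cons p1 h1).cons p0 h0))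
  have hlen : (((l.map Subtype.val (fun _ _ ↦ id)).cons p1 h1).cons p0 h0).length
      = l.length + 2 := by
    refine (RelSeries.cons_length _ _ _).trans (congrArg (· + 1) ?_)
    exact RelSeries.cons_length _ _ _
  rw [hlen]
  push_cast
  exact le_rfl

end SLQT

/-!
**Statement 16.** Let `W` be the affine space of linear maps from `ℂ^{n+1}` to `ℂⁿ`
(`n ≥ 2`), i.e. of `n × (n+1)` complex matrices, with `SLₙ(ℂ)` acting by postcomposition
(left multiplication).  Then:
1. the action is free exactly on the open set `U` of surjective linear maps;
2. `U ⫽ SLₙ(ℂ) ≅ 𝔸^{n+1} ∖ {0}` and `W ⫽ SLₙ(ℂ) ≅ 𝔸^{n+1}`: the map `μ` of maximal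
   minors is `SLₙ`-invariant, it is nonzero exactly on `U`, its nonzero fibers are single
   `SLₙ`-orbits, it is surjective onto `ℂ^{n+1}`, and every `SLₙ`-invariant polynomial
   function on `W` factors through `μ` (so `μ` identifies the GIT quotients);
3. the complement of `U` in `W` (the fiber of `μ` over `0`, cut out by the vanishing of
   all maximal minors) has codimension `≥ 2`.
Hence `W → 𝔸^{n+1}` is an `SLₙ(ℂ)`-quasi-torsor over the smooth germ `(𝔸^{n+1}; 0)`
that is not a torsor (there are points over `0` with nontrivial stabilizer).
-/
theorem sl_quasi_torsor_over_affine_space (n : ℕ) (hn : 2 ≤ n) :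
    -- (1) freeness exactly at surjective maps
    (∀ A : Matrix (Fin n) (Fin (n + 1)) ℂ,
      (∀ g : SpecialLinearGroup (Fin n) ℂ, (g : Matrix (Fin n) (Fin n) ℂ) * A = A → g = 1)
        ↔ Function.Surjective A.mulVecLin) ∧
    -- (2) the minors map is SLₙ-invariant
    (∀ (g : SpecialLinearGroup (Fin n) ℂ) (A : Matrix (Fin n) (Fin (n + 1)) ℂ),
      maximalMinors n ((g : Matrix (Fin n) (Fin n) ℂ) * A) = maximalMinors n A) ∧
    -- (2) it is nonzero exactly on the surjective locus U
    (∀ A : Matrix (Fin n) (Fin (n + 1)) ℂ,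
      maximalMinors n A ≠ 0 ↔ Function.Surjective A.mulVecLin) ∧
    -- (2) over a nonzero value, the fiber is a single SLₙ-orbit: U ⫽ SLₙ ≅ 𝔸^{n+1} ∖ {0}
    (∀ A B : Matrix (Fin n) (Fin (n + 1)) ℂ, Function.Surjective A.mulVecLin →
      maximalMinors n A = maximalMinors n B →
      ∃ g : SpecialLinearGroup (Fin n) ℂ, (g : Matrix (Fin n) (Fin n) ℂ) * A = B) ∧
    -- (2) μ is surjective onto 𝔸^{n+1}
    (Function.Surjective (maximalMinors n)) ∧
    -- (2) every SLₙ-invariant polynomial factors through μ : W ⫽ SLₙ ≅ 𝔸^{n+1}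
    (∀ F : MvPolynomial (Fin n × Fin (n + 1)) ℂ,
      (∀ (g : SpecialLinearGroup (Fin n) ℂ) (A : Matrix (Fin n) (Fin (n + 1)) ℂ),
        MvPolynomial.eval (fun p => ((g : Matrix (Fin n) (Fin n) ℂ) * A) p.1 p.2) F
          = MvPolynomial.eval (fun p => A p.1 p.2) F) →
      ∃ Gp : MvPolynomial (Fin (n + 1)) ℂ, ∀ A : Matrix (Fin n) (Fin (n + 1)) ℂ,
        MvPolynomial.eval (fun p => A p.1 p.2) F
          = MvPolynomial.eval (maximalMinors n A) Gp) ∧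
    -- (3) the non-free locus μ⁻¹(0) has codimension ≥ 2 in W ≅ 𝔸^{n²+n}
    (ringKrullDim
        (MvPolynomial (Fin n × Fin (n + 1)) ℂ ⧸
          Ideal.span (Set.range fun i : Fin (n + 1) => minorPoly n i)) + 2
      ≤ ringKrullDim (MvPolynomial (Fin n × Fin (n + 1)) ℂ)) ∧
    -- hence W → 𝔸^{n+1} is a quasi-torsor that is not a torsor
    (∃ A : Matrix (Fin n) (Fin (n + 1)) ℂ, maximalMinors n A = 0 ∧
      ∃ g : SpecialLinearGroup (Fin n) ℂ, g ≠ 1 ∧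
        (g : Matrix (Fin n) (Fin n) ℂ) * A = A) := by
  refine ⟨SLQT.free_iff n hn, ?_, SLQT.minors_ne_zero_iff n, ?_, SLQT.minors_surjective n hn,
    SLQT.factor n hn, SLQT.codim n, 0, SLQT.minors_zero n hn, ?_⟩
  · intro g A
    ext i
    rw [SLQT.minors_mul, g.det_coe, one_mul]
  · intro A B hA h
    exact SLQT.single_orbit n A B ((SLQT.minors_ne_zero_iff n A).mpr hA) h
  · apply SLQT.exists_stab n hn
    rw [← SLQT.minors_ne_zero_iff]
    simp [SLQT.minors_zero n hn]
end

section
/- Let X be the affine hypersurface {xy + zw + z³ + w³ = 0} ⊂ 𝔸⁴ and x_0 the origin. Then X is factorial at x_0 (the local ring O_{X,x_0} is a UFD) but not analytically factorial at x_0 (the completion of O_{X,x_0} is not a UFD). -/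
open MvPolynomial in
/-- The coordinate ring `ℂ[x,y,z,w]/(xy + zw + z³ + w³)` of the affine hypersurface `X`. -/
noncomputable abbrev hypersurfaceRing : Type :=
  MvPolynomial (Fin 4) ℂ ⧸ Ideal.span
    ({X 0 * X 1 + X 2 * X 3 + X 2 ^ 3 + X 3 ^ 3} : Set (MvPolynomial (Fin 4) ℂ))

open MvPolynomial in
/-- The maximal ideal of the origin `x₀ = (0,0,0,0) ∈ X`. -/
noncomputable abbrev originIdeal : Ideal hypersurfaceRing :=
  Ideal.span (Set.range fun i : Fin 4 =>
    (Ideal.Quotient.mk _ (X i : MvPolynomial (Fin 4) ℂ) : hypersurfaceRing))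

open MvPowerSeries in
/-- The complete local ring `ℂ[[x,y,z,w]]/(xy + zw + z³ + w³)`, i.e. the completion
`Ô_{X,x₀}` of the local ring of `X` at the origin. -/
noncomputable abbrev completedRing : Type :=
  MvPowerSeries (Fin 4) ℂ ⧸ Ideal.span
    ({X 0 * X 1 + X 2 * X 3 + X 2 ^ 3 + X 3 ^ 3} : Set (MvPowerSeries (Fin 4) ℂ))

namespace FactHyp

/-- Nagata-type criterion. -/
theorem nagata {B R : Type*} [CommRing B] [IsDomain B] [UniqueFactorizationMonoid B]
    [CommRing R] [IsDomain R] [IsNoetherianRing R] (j : B →+* R) (hj : Function.Injective j)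
    (x : B) (hx : Prime (j x)) (hsurj : ∀ r : R, ∃ n : ℕ, ∃ b : B, j x ^ n * r = j b) :
    UniqueFactorizationMonoid R := by
  rw [UniqueFactorizationMonoid.iff_exists_prime_mem_of_isPrime]
  intro Q hQ0 hQ
  by_cases hxQ : j x ∈ Q
  · exact ⟨_, hxQ, hx⟩
  have hne : Q.comap j ≠ ⊥ := by
    obtain ⟨r, hr, hr0⟩ := Submodule.exists_mem_ne_zero_of_ne_bot hQ0
    obtain ⟨n, b, hb⟩ := hsurj r
    intro h
    have : b ∈ Q.comap j := by
      rw [Ideal.mem_comap, ← hb]; exact Q.mul_mem_left _ hr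
    rw [h, Ideal.mem_bot] at this
    rw [this, map_zero] at hb
    exact mul_ne_zero (pow_ne_zero _ hx.ne_zero) hr0 hb
  obtain ⟨p, hpQ, hp⟩ := (hQ.comap j).exists_mem_prime_of_ne_bot hne
  rw [Ideal.mem_comap] at hpQ
  have hpx : ¬ p ∣ x := by
    rintro ⟨c, hc⟩
    exact hxQ (by rw [hc, map_mul]; exact Q.mul_mem_right _ hpQ)
  have hjp0 : j p ≠ 0 := by
    intro h; exact hp.ne_zero (hj (by rw [h, map_zero]))
  obtain ⟨k, q, hxq, hpq⟩ := WfDvdMonoid.max_power_factor hjp0 hx.irreducible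
  have hqQ : q ∈ Q := by
    rw [hpq] at hpQ
    rcases hQ.mem_or_mem hpQ with h | h
    · exact absurd (hQ.mem_of_pow_mem _ h) hxQ
    · exact h
  have key : ∀ (a : R) (n : ℕ) (a' : B), j x ^ n * a = j a' → p ∣ a' → q ∣ a := by
    rintro a n a' h ⟨c, rfl⟩
    have h1 : q ∣ j x ^ n * a := ⟨j x ^ k * j c, by rw [h, map_mul, hpq]; ring⟩
    obtain ⟨d, hd⟩ := h1
    have h2 : j x ^ n ∣ q * d := ⟨a, hd.symm⟩
    obtain ⟨e, rfl⟩ := hx.pow_dvd_of_dvd_mul_left n hxq h2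
    refine ⟨e, mul_left_cancel₀ (pow_ne_zero n hx.ne_zero) ?_⟩
    rw [hd]; ring
  refine ⟨q, hqQ, ?_, ?_, ?_⟩
  · rintro rfl; exact hxq (dvd_zero _)
  · intro h; exact hQ.ne_top (Ideal.eq_top_of_isUnit_mem _ hqQ h)
  · rintro a b ⟨c, hc⟩
    obtain ⟨n, a', ha⟩ := hsurj a
    obtain ⟨m, b', hb⟩ := hsurj b
    obtain ⟨l, c', hc'⟩ := hsurj c
    have : p * (x ^ (n + m) * c') = x ^ (l + k) * (a' * b') := by
      apply hj
      simp only [map_mul, map_pow]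
      rw [← ha, ← hb, ← hc', hpq]
      linear_combination -(j x ^ (n + m + l + k)) * hc
    have h2 : p ∣ x ^ (l + k) * (a' * b') := ⟨_, this.symm⟩
    rcases hp.dvd_or_dvd h2 with h3 | h3
    · exact absurd (hp.dvd_of_dvd_pow h3) hpx
    · rcases hp.dvd_or_dvd h3 with h4 | h4
      · exact .inl (key a n a' ha h4)
      · exact .inr (key b m b' hb h4)

section cubic
open Polynomial

theorem no_root (r : ℂ[X]) : r ^ 3 + X * r + X ^ 3 ≠ 0 := by
  intro h
  have h1 : r ∣ X ^ 3 := ⟨-(r ^ 2 + X), by linear_combination h⟩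
  obtain ⟨i, hi, hr⟩ := (dvd_prime_pow (Polynomial.prime_X (R := ℂ)) 3).1 h1
  obtain ⟨u, hu⟩ := hr.symm
  obtain ⟨c, hc, hcu⟩ := Polynomial.isUnit_iff.1 u.isUnit
  rw [← hcu] at hu
  rw [← hu] at h
  have hc0 : c ≠ 0 := hc.ne_zero
  interval_cases i
  · have := congrArg (fun p => eval 0 p) h
    simp at this
    exact hc0 this
  · have := congrArg (fun p => coeff p 2) h
    have e : (X ^ 1 * C c) ^ 3 + X * (X ^ 1 * C c) + X ^ 3 = C (c ^ 3 + 1) * X ^ 3 + C c * X ^ 2 := by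
      simp; ring
    rw [e] at this
    simp only [coeff_add, coeff_C_mul, coeff_X_pow, coeff_zero] at this
    norm_num at this
    exact hc0 this
  · have := congrArg (fun p => coeff p 6) h
    have e : (X ^ 2 * C c) ^ 3 + X * (X ^ 2 * C c) + X ^ 3 = C (c ^ 3) * X ^ 6 + C (c + 1) * X ^ 3 := by
      simp; ring
    rw [e] at this
    simp only [coeff_add, coeff_C_mul, coeff_X_pow, coeff_zero] at this
    norm_num at this
    exact hc0 this
  · have := congrArg (fun p => coeff p 9) h
    have e : (X ^ 3 * C c) ^ 3 + X * (X ^ 3 * C c) + X ^ 3 = C (c ^ 3) * X ^ 9 + C c * X ^ 4 + X ^ 3 := by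
      simp; ring
    rw [e] at this
    simp only [coeff_add, coeff_C_mul, coeff_X_pow, coeff_zero] at this
    norm_num at this
    exact hc0 this

theorem cubic_prime : Prime (X ^ 3 + C (MvPolynomial.X 0) * X + C (MvPolynomial.X 0 ^ 3) :
    (MvPolynomial (Fin 3) ℂ)[X]) := by
  rw [← UniqueFactorizationMonoid.irreducible_iff_prime]
  set p : (MvPolynomial (Fin 3) ℂ)[X] := X ^ 3 + C (MvPolynomial.X 0) * X + C (MvPolynomial.X 0 ^ 3)
    with hp
  have hm : p.Monic := by rw [hp]; monicity!
  have hd : p.natDegree = 3 := by rw [hp]; compute_degree!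
  rw [hm.irreducible_iff_roots_eq_zero_of_degree_le_three (by omega) (by omega),
    Multiset.eq_zero_iff_forall_notMem]
  intro r hr
  rw [mem_roots hm.ne_zero, IsRoot.def, hp] at hr
  apply no_root (MvPolynomial.aeval (fun _ => (X : ℂ[X])) r)
  have := congrArg (MvPolynomial.aeval (fun _ => (X : ℂ[X]))) hr
  simpa using this

end cubic

open MvPolynomial

/-- The nodal cubic. -/
noncomputable def gP : MvPolynomial (Fin 4) ℂ := X 2 * X 3 + X 2 ^ 3 + X 3 ^ 3

theorem gP_prime : Prime gP := by
  let e : MvPolynomial (Fin 4) ℂ ≃ₐ[ℂ] Polynomial (MvPolynomial (Fin 3) ℂ) :=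
    (renameEquiv ℂ ((Equiv.swap (0 : Fin 4) 2).trans (Equiv.swap 1 3))).trans (finSuccEquiv ℂ 3)
  rw [← MulEquiv.prime_iff e.toMulEquiv]
  convert cubic_prime using 1
  have h2 : e (X 2) = Polynomial.X := by
    have : ((Equiv.swap (0 : Fin 4) 2).trans (Equiv.swap 1 3)) 2 = 0 := by decide
    simp only [e, AlgEquiv.trans_apply, renameEquiv_apply, rename_X, this, finSuccEquiv_X_zero]
  have h3 : e (X 3) = Polynomial.C (X 0) := by
    have : ((Equiv.swap (0 : Fin 4) 2).trans (Equiv.swap 1 3)) 3 = Fin.succ 0 := by decide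
    simp only [e, AlgEquiv.trans_apply, renameEquiv_apply, rename_X, this, finSuccEquiv_X_succ]
  change e gP = _
  simp only [gP, map_add, map_mul, map_pow, h2, h3]
  ring

/-- The nodal cubic in three variables. -/
noncomputable def gB : MvPolynomial (Fin 3) ℂ := X 1 * X 2 + X 1 ^ 3 + X 2 ^ 3

theorem rename_gB : rename (![0, 2, 3] : Fin 3 → Fin 4) gB = gP := by
  simp [gB, gP]

/-- The equation. -/
noncomputable abbrev fP : MvPolynomial (Fin 4) ℂ := X 0 * X 1 + X 2 * X 3 + X 2 ^ 3 + X 3 ^ 3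

theorem fP_eq : fP = X 0 * X 1 + gP := by rw [fP, gP]; ring

theorem fP_prime : Prime fP := by
  rw [← UniqueFactorizationMonoid.irreducible_iff_prime, fP_eq]
  apply irreducible_mul_X_add _ _ _ (X_ne_zero _)
  · simp
  · rw [← rename_gB]
    intro h
    obtain ⟨i, -, hi⟩ := mem_vars_rename _ _ h
    fin_cases i <;> simp at hi
  · rw [(X_prime (R := ℂ) (i := (0 : Fin 4))).irreducible.isRelPrime_iff_not_dvd]
    rintro ⟨c, hc⟩
    have := congrArg (eval (![0, 0, 1, 0] : Fin 4 → ℂ)) hc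
    simp [gP] at this

instance : IsDomain hypersurfaceRing := by
  rw [Ideal.Quotient.isDomain_iff_prime, Ideal.span_singleton_prime fP_prime.ne_zero]
  exact fP_prime

/-- The quotient map. -/
noncomputable abbrev q : MvPolynomial (Fin 4) ℂ →+* hypersurfaceRing := Ideal.Quotient.mk _

theorem q_rel : q (X 0) * q (X 1) + q gP = 0 := by
  rw [← map_mul, ← map_add, ← fP_eq]
  exact Ideal.Quotient.eq_zero_iff_mem.2 (Ideal.subset_span rfl)

/-- Inclusion of the polynomial ring in `x, z, w`. -/
noncomputable def j : MvPolynomial (Fin 3) ℂ →+* hypersurfaceRing :=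
  q.comp (rename (![0, 2, 3] : Fin 3 → Fin 4)).toRingHom

theorem j_X0 : j (X 0) = q (X 0) := by simp [j]
theorem j_X1 : j (X 1) = q (X 2) := by simp [j]
theorem j_X2 : j (X 2) = q (X 3) := by simp [j]
theorem j_gB : j gB = q gP := by rw [← rename_gB]; rfl

theorem j_inj : Function.Injective j := by
  let K := FractionRing (MvPolynomial (Fin 3) ℂ)
  let a : MvPolynomial (Fin 3) ℂ →ₐ[ℂ] K := IsScalarTower.toAlgHom ℂ _ _
  have ha : Function.Injective a := IsFractionRing.injective _ K
  let φ : MvPolynomial (Fin 4) ℂ →ₐ[ℂ] K :=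
    aeval ![a (X 0), - a gB / a (X 0), a (X 1), a (X 2)]
  have hc : φ.comp (rename (![0, 2, 3] : Fin 3 → Fin 4)) = a := by
    apply MvPolynomial.algHom_ext
    intro i
    fin_cases i <;> simp [φ]
  have hx : a (X 0) ≠ 0 := by
    intro h; exact X_ne_zero (0 : Fin 3) (ha (by rw [h, map_zero]))
  have hf : φ fP = 0 := by
    rw [fP_eq, ← rename_gB, map_add, ← AlgHom.comp_apply, hc]
    have h0 : φ (X 0) = a (X 0) := by simp [φ]
    have h1 : φ (X 1) = - a gB / a (X 0) := by simp [φ]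
    rw [map_mul, h0, h1, mul_div_cancel₀ _ hx, neg_add_cancel]
  rw [injective_iff_map_eq_zero]
  intro b hb
  have hb' : rename (![0, 2, 3] : Fin 3 → Fin 4) b ∈ Ideal.span {fP} :=
    Ideal.Quotient.eq_zero_iff_mem.1 hb
  obtain ⟨c, hc'⟩ := Ideal.mem_span_singleton.1 hb'
  apply ha
  rw [map_zero, ← hc, AlgHom.comp_apply, hc', map_mul, hf, zero_mul]

theorem j_surj (r : hypersurfaceRing) : ∃ n : ℕ, ∃ b, j (X 0) ^ n * r = j b := by
  obtain ⟨p, rfl⟩ := Ideal.Quotient.mk_surjective r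
  induction p using MvPolynomial.induction_on with
  | C a => exact ⟨0, C a, by simp [j]⟩
  | add p p' h h' =>
    obtain ⟨n, b, h⟩ := h
    obtain ⟨m, c, h'⟩ := h'
    refine ⟨n + m, X 0 ^ m * b + X 0 ^ n * c, ?_⟩
    simp only [map_add, map_mul, map_pow, ← h, ← h']
    ring
  | mul_X p i h =>
    obtain ⟨n, b, h⟩ := h
    have h0 := j_X0
    have hr := q_rel
    rw [← j_X0, ← j_gB] at hr
    have : i = 0 ∨ i = 1 ∨ i = 2 ∨ i = 3 := by fin_cases i <;> simp
    rcases this with rfl | rfl | rfl | rfl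
    · exact ⟨n, b * X 0, by rw [map_mul, map_mul, ← h, j_X0]; ring⟩
    · refine ⟨n + 1, - b * gB, ?_⟩
      rw [map_mul, map_mul, map_neg, ← h]
      linear_combination (j (X 0) ^ n * q p) * hr
    · exact ⟨n, b * X 1, by rw [map_mul, map_mul, ← h, j_X1]; ring⟩
    · exact ⟨n, b * X 2, by rw [map_mul, map_mul, ← h, j_X2]; ring⟩

theorem q_X0_prime : Prime (q (X 0)) := by
  let φ : MvPolynomial (Fin 4) ℂ →ₐ[ℂ] MvPolynomial (Fin 4) ℂ := aeval ![0, X 1, X 2, X 3]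
  have hφ : ∀ p, X 0 ∣ p - φ p := by
    intro p
    induction p using MvPolynomial.induction_on with
    | C a => simp [φ]
    | add p p' h h' =>
      rw [map_add, add_sub_add_comm]; exact dvd_add h h'
    | mul_X p i h =>
      obtain ⟨c, hc⟩ := h
      have : i = 0 ∨ i = 1 ∨ i = 2 ∨ i = 3 := by fin_cases i <;> simp
      rcases this with rfl | rfl | rfl | rfl
      · simp [φ]
      · have h1 : φ (X 1) = X 1 := by simp [φ]
        rw [map_mul, h1]
        exact ⟨c * X 1, by linear_combination X 1 * hc⟩
      · have h2 : φ (X 2) = X 2 := by simp [φ]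
        rw [map_mul, h2]
        exact ⟨c * X 2, by linear_combination X 2 * hc⟩
      · have h3 : φ (X 3) = X 3 := by simp [φ]
        rw [map_mul, h3]
        exact ⟨c * X 3, by linear_combination X 3 * hc⟩
  have hφg : φ gP = gP := by simp [φ, gP]
  have hφf : φ fP = gP := by simp [φ, gP]
  have key : ∀ p, q (X 0) ∣ q p ↔ gP ∣ φ p := by
    intro p
    constructor
    · rintro ⟨c, hc⟩
      obtain ⟨c, rfl⟩ := Ideal.Quotient.mk_surjective c
      rw [← map_mul, Ideal.Quotient.eq, Ideal.mem_span_singleton] at hc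
      have := map_dvd φ hc
      change φ fP ∣ _ at this
      rw [hφf] at this
      simpa [φ] using this
    · rintro ⟨d, hd⟩
      obtain ⟨c, hc⟩ := hφ p
      refine ⟨q c - q (X 1) * q d, ?_⟩
      have : p = X 0 * c + gP * d := by rw [← hc, ← hd]; ring
      rw [this, map_add, map_mul, map_mul]
      linear_combination q d * q_rel
  refine ⟨?_, ?_, ?_⟩
  · intro h
    have := (key 1).1
    have hz := Ideal.mem_span_singleton.1 (Ideal.Quotient.eq_zero_iff_mem.1 h)
    have := map_dvd (eval (![1, 0, 0, 0] : Fin 4 → ℂ)) hz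
    simp at this
  · intro h
    have := (key 1).1 (by rw [map_one]; exact h.dvd)
    rw [map_one] at this
    exact gP_prime.not_isUnit (isUnit_of_dvd_one this)
  · intro a b h
    obtain ⟨a, rfl⟩ := Ideal.Quotient.mk_surjective a
    obtain ⟨b, rfl⟩ := Ideal.Quotient.mk_surjective b
    rw [← map_mul] at h
    have := (key _).1 h
    rw [map_mul] at this
    exact (gP_prime.dvd_or_dvd this).imp (key a).2 (key b).2

theorem ufd : UniqueFactorizationMonoid hypersurfaceRing :=
  nagata j j_inj (X 0) (by rw [j_X0]; exact q_X0_prime) j_surj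

section completed
open MvPowerSeries

/-- The ring of power series. -/
abbrev PS := MvPowerSeries (Fin 4) ℂ

/-- Linear coefficient. -/
noncomputable def L (i : Fin 4) (p : PS) : ℂ := constantCoeff (pderiv ℂ i p)

theorem L_add (i) (p r : PS) : L i (p + r) = L i p + L i r := by simp [L]
theorem L_mul (i) (p r : PS) :
    L i (p * r) = constantCoeff p * L i r + constantCoeff r * L i p := by
  simp [L, Derivation.leibniz]
theorem L_X (i k) : L i (MvPowerSeries.X k : PS) = if i = k then 1 else 0 := by
  classical
  have := coeff_pderiv (i := i) (MvPowerSeries.X k : PS) 0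
  rw [L, ← MvPowerSeries.coeff_zero_eq_constantCoeff_apply, this, MvPowerSeries.coeff_X]
  simp [Finsupp.single_left_inj]

/-- The equation. -/
noncomputable abbrev fS : PS :=
  MvPowerSeries.X 0 * MvPowerSeries.X 1 + MvPowerSeries.X 2 * MvPowerSeries.X 3
    + MvPowerSeries.X 2 ^ 3 + MvPowerSeries.X 3 ^ 3

theorem c_f : constantCoeff fS = 0 := by simp [fS]
theorem L_f (i) : L i fS = 0 := by simp [fS, L_add, L_mul, pow_succ]

/-- The quotient map. -/
noncomputable abbrev qS : PS →+* completedRing := Ideal.Quotient.mk _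

theorem qS_eq {a b : PS} (h : qS a = qS b) :
    constantCoeff a = constantCoeff b ∧ ∀ i, L i a = L i b := by
  rw [Ideal.Quotient.eq, Ideal.mem_span_singleton] at h
  obtain ⟨c, hc⟩ := h
  have : a = b + fS * c := by rw [← hc]; ring
  rw [this]
  constructor
  · rw [map_add, map_mul, c_f]; ring
  · intro i
    rw [L_add, L_mul, c_f, L_f]; ring

theorem qS_irr : Irreducible (qS (MvPowerSeries.X 0)) := by
  constructor
  · rintro h
    obtain ⟨b, hb⟩ := h.exists_right_inv
    obtain ⟨b, rfl⟩ := Ideal.Quotient.mk_surjective b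
    rw [← map_mul, ← map_one qS] at hb
    simpa using (qS_eq hb).1
  · intro a b h
    obtain ⟨a, rfl⟩ := Ideal.Quotient.mk_surjective a
    obtain ⟨b, rfl⟩ := Ideal.Quotient.mk_surjective b
    rw [← map_mul] at h
    have h1 := (qS_eq h).2 0
    rw [L_mul, L_X, if_pos rfl] at h1
    by_cases ha : constantCoeff a = 0
    · by_cases hb : constantCoeff b = 0
      · simp [ha, hb] at h1
      · right
        exact (MvPowerSeries.isUnit_iff_constantCoeff.2 (isUnit_iff_ne_zero.2 hb)).map qS
    · left
      exact (MvPowerSeries.isUnit_iff_constantCoeff.2 (isUnit_iff_ne_zero.2 ha)).map qS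

theorem exists_alpha (s : PS) (hs : constantCoeff s = 0) : ∃ α : PS, α ^ 2 * s + 1 = α := by
  have h := congrArg (PowerSeries.map (Nat.castRingHom ℂ)) PowerSeries.catalanSeries_sq_mul_X_add_one
  have hs' : PowerSeries.HasSubst s := PowerSeries.HasSubst.of_constantCoeff_zero hs
  have h2 := congrArg (PowerSeries.substAlgHom (R := ℂ) hs') h
  refine ⟨PowerSeries.substAlgHom (R := ℂ) hs'
    (PowerSeries.map (Nat.castRingHom ℂ) PowerSeries.catalanSeries), ?_⟩
  simpa [PowerSeries.substAlgHom_X] using h2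

theorem not_ufd [IsDomain completedRing] : ¬ UniqueFactorizationMonoid completedRing := by
  intro hU
  have hp : Prime (qS (MvPowerSeries.X 0)) :=
    UniqueFactorizationMonoid.irreducible_iff_prime.1 qS_irr
  obtain ⟨α, hα⟩ := exists_alpha (MvPowerSeries.X 2 * MvPowerSeries.X 3) (by simp)
  set z : PS := MvPowerSeries.X 2 with hz
  set w : PS := MvPowerSeries.X 3 with hw
  have hdvd : qS (MvPowerSeries.X 0) ∣ qS (z + w ^ 2 * α) * qS (w + z ^ 2 * α) := by
    refine ⟨qS (- MvPowerSeries.X 1 * α), ?_⟩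
    rw [← map_mul, ← map_mul, Ideal.Quotient.eq, Ideal.mem_span_singleton]
    refine ⟨α, ?_⟩
    linear_combination z * w * hα
  rcases hp.dvd_or_dvd hdvd with ⟨c, hc⟩ | ⟨c, hc⟩
  · obtain ⟨c, rfl⟩ := Ideal.Quotient.mk_surjective c
    rw [← map_mul] at hc
    have := (qS_eq hc).2 2
    simp [L_add, L_mul, L_X, hz, hw, pow_succ] at this
  · obtain ⟨c, rfl⟩ := Ideal.Quotient.mk_surjective c
    rw [← map_mul] at hc
    have := (qS_eq hc).2 3
    simp [L_add, L_mul, L_X, hz, hw, pow_succ] at this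

end completed

end FactHyp

/-!
**Statement 19.** Let `X` be the affine hypersurface `{xy + zw + z³ + w³ = 0} ⊂ 𝔸⁴` and
`x₀` the origin.  Then `X` is factorial at `x₀` (the local ring `O_{X,x₀}` is a UFD) but
not analytically factorial at `x₀` (the completion of `O_{X,x₀}`, which is
`ℂ[[x,y,z,w]]/(xy + zw + z³ + w³)`, is not a UFD).

The instance hypotheses record the (true, elementary) facts that the maximal ideal of
the origin is prime and that the rings in question are domains, which are needed to even
state unique factorization.
-/
theorem factorial_but_not_analytically_factorial
    [originIdeal.IsPrime]
    [IsDomain (Localization.AtPrime originIdeal)]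
    [IsDomain completedRing] :
    UniqueFactorizationMonoid (Localization.AtPrime originIdeal) ∧
      ¬ UniqueFactorizationMonoid completedRing := by
  refine ⟨?_, FactHyp.not_ufd⟩
  have := FactHyp.ufd
  infer_instance
end
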